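/- arXiv:2510.07883 — 8 statements merged into one kernel-verified Lean document; each statement's English description precedes it below -/
import Mathlib

section
/- Let 𝐗 be a proper metric space and 𝐗₀ ⊆ 𝐗 a closed subset. Then the set of all f ∈ C₀(𝐗, ℂ) for which there exists r > 0 such that f y = 0 whenever dist y x₀ < r for some x₀ ∈ 𝐗₀ (i.e. f vanishes on the open r-neighborhood of 𝐗₀) is dense, with respect to the sup norm, in the set {f ∈ C₀(𝐗, ℂ) : f x₀ = 0 for all x₀ ∈ 𝐗₀}. -/
open scoped ZeroAtInfty

/-- Soft thresholding at level `ε`: shrinks the modulus of `z` by `ε`, down to `0` at least. -/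
noncomputable def softThreshold (ε : ℝ) (z : ℂ) : ℂ :=
  z * ((1 - ε / max ‖z‖ ε : ℝ) : ℂ)

theorem continuous_softThreshold {ε : ℝ} (hε : 0 < ε) : Continuous (softThreshold ε) := by
  have hne : ∀ z : ℂ, max ‖z‖ ε ≠ 0 := fun z => (lt_max_of_lt_right hε).ne'
  unfold softThreshold
  fun_prop (disch := exact hne _)

theorem softThreshold_eq_zero {ε : ℝ} (hε : 0 < ε) {z : ℂ} (hz : ‖z‖ ≤ ε) :
    softThreshold ε z = 0 := by
  simp [softThreshold, max_eq_right hz, hε.ne']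

theorem dist_softThreshold_le {ε : ℝ} (hε : 0 < ε) (z : ℂ) :
    dist (softThreshold ε z) z ≤ ε := by
  have hmax : 0 < max ‖z‖ ε := lt_max_of_lt_right hε
  have hsub : softThreshold ε z - z = -(z * ((ε / max ‖z‖ ε : ℝ) : ℂ)) := by
    simp only [softThreshold, Complex.ofReal_sub, Complex.ofReal_one]
    ring
  rw [dist_eq_norm, hsub, norm_neg, norm_mul, Complex.norm_real, Real.norm_of_nonneg (by positivity),
    mul_div_assoc', div_le_iff₀ hmax, mul_comm]
  exact mul_le_mul_of_nonneg_left (le_max_left _ _) hε.le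

namespace ZeroAtInftyContinuousMap

/-- Pointwise soft thresholding of a continuous function vanishing at infinity. -/
noncomputable def softThreshold {X : Type*} [TopologicalSpace X] (f : C₀(X, ℂ)) {ε : ℝ}
    (hε : 0 < ε) : C₀(X, ℂ) where
  toFun x := _root_.softThreshold ε (f x)
  continuous_toFun := (continuous_softThreshold hε).comp f.continuous_toFun
  zero_at_infty' := by
    have h := (continuous_softThreshold hε).tendsto 0
    rw [softThreshold_eq_zero hε (by simpa using hε.le)] at h
    exact h.comp f.zero_at_infty'

theorem dist_softThreshold_le {X : Type*} [TopologicalSpace X] (f : C₀(X, ℂ)) {ε : ℝ}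
    (hε : 0 < ε) : dist (f.softThreshold hε) f ≤ ε := by
  rw [← dist_toBCF_eq_dist, BoundedContinuousFunction.dist_le hε.le]
  exact fun x => _root_.dist_softThreshold_le hε (f x)

end ZeroAtInftyContinuousMap

/-- paper's Lemma 3.3.
Let `𝐗` be a proper metric space and `𝐗₀ ⊆ 𝐗` a closed subset.  The functions in
`C₀(𝐗, ℂ)` vanishing on some open `r`-neighborhood of `𝐗₀` (for some `r > 0`) are
dense (sup norm) in the set of functions in `C₀(𝐗, ℂ)` vanishing on `𝐗₀`. -/
theorem dense_vanishing_near_closed_subset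
    {X : Type*} [MetricSpace X] [ProperSpace X]
    (X₀ : Set X) (hX₀ : IsClosed X₀) :
    {f : C₀(X, ℂ) | ∀ x₀ ∈ X₀, f x₀ = 0} ⊆
      closure {f : C₀(X, ℂ) |
        ∃ r > (0 : ℝ), ∀ y : X, (∃ x₀ ∈ X₀, dist y x₀ < r) → f y = 0} := by
  intro f hf
  rw [Metric.mem_closure_iff]
  intro ε hε
  have hε' : 0 < ε / 2 := half_pos hε
  obtain ⟨r, hr, hfr⟩ := Metric.uniformContinuous_iff.mp
    (ZeroAtInftyContinuousMap.uniformContinuous f) (ε / 2) hε'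
  refine ⟨f.softThreshold hε', ⟨r, hr, ?_⟩, ?_⟩
  · rintro y ⟨x₀, hx₀, hy⟩
    have hfy := hfr hy
    rw [hf x₀ hx₀, dist_zero_right] at hfy
    exact softThreshold_eq_zero hε' hfy.le
  · rw [dist_comm]
    exact (f.dist_softThreshold_le hε').trans_lt (half_lt_self hε)
end

section
/- Let 𝐗 be a metric space with a scaling (sc, ρ), and let 𝐗₀ ⊆ 𝐗 be a nonempty subset such that sc t x₀ ∈ 𝐗₀ for all t ≥ 0 and x₀ ∈ 𝐗₀. Then for all R > 0 and r > 0 there exists N ≥ 0 such that for every x ∈ 𝐗 with Metric.infDist x 𝐗₀ < R and every t ≥ N one has Metric.infDist (sc t x) 𝐗₀ < r. -/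
open Filter

/-- paper's Lemma 3.6, first part.
Let `𝐗` be a metric space with a scaling `(sc, ρ)` and `𝐗₀ ⊆ 𝐗` a nonempty subset
invariant under the scaling.  Then for all `R > 0` and `r > 0` there is `N ≥ 0`
such that `infDist x 𝐗₀ < R` implies `infDist (sc t x) 𝐗₀ < r` for all `t ≥ N`. -/
theorem scaling_infDist_small_eventually
    {X : Type*} [MetricSpace X]
    (sc : ℝ → X → X) (ρ : ℝ → ℝ → ℝ)
    (hρ_nonneg : ∀ t ≥ (0:ℝ), ∀ r ≥ (0:ℝ), 0 ≤ ρ t r)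
    (hS3 : ∀ t ≥ (0:ℝ), ∀ x y : X, dist (sc t x) (sc t y) ≤ ρ t (dist x y))
    (hS4 : ∀ t ≥ (0:ℝ), MonotoneOn (ρ t) (Set.Ici (0:ℝ)))
    (hS5bdd : ∀ r ≥ (0:ℝ), ∃ C : ℝ, ∀ t ≥ (0:ℝ), ρ t r ≤ C)
    (hS5lim : ∀ r ≥ (0:ℝ), Tendsto (fun t => ρ t r) atTop (nhds 0))
    (X₀ : Set X) (hne : X₀.Nonempty)
    (hinv : ∀ t ≥ (0:ℝ), ∀ x₀ ∈ X₀, sc t x₀ ∈ X₀) :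
    ∀ R > (0:ℝ), ∀ r > (0:ℝ), ∃ N ≥ (0:ℝ), ∀ x : X,
      Metric.infDist x X₀ < R → ∀ t ≥ N, Metric.infDist (sc t x) X₀ < r := by
  intro R hR r hr
  obtain ⟨N, hN⟩ := eventually_atTop.1 ((hS5lim R hR.le).eventually_lt_const hr)
  refine ⟨max N 0, le_max_right N 0, fun x hx t ht => ?_⟩
  have ht0 : 0 ≤ t := (le_max_right N 0).trans ht
  obtain ⟨y, hy, hxy⟩ := (Metric.infDist_lt_iff hne).1 hx
  calc Metric.infDist (sc t x) X₀ ≤ dist (sc t x) (sc t y) :=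
        Metric.infDist_le_dist_of_mem (hinv t ht0 y hy)
    _ ≤ ρ t (dist x y) := hS3 t ht0 x y
    _ ≤ ρ t R := hS4 t ht0 dist_nonneg hR.le hxy.le
    _ < r := hN t ((le_max_left N 0).trans ht)
end

section
/- Let 𝐗 be a metric space with a scaling (sc, ρ), and let 𝐗₀ ⊆ 𝐗 be a nonempty subset such that sc t x₀ ∈ 𝐗₀ for all t ≥ 0 and x₀ ∈ 𝐗₀. Then for every R > 0 there exists r > 0 such that for every x ∈ 𝐗 with Metric.infDist x 𝐗₀ < R and every t ≥ 0 one has Metric.infDist (sc t x) 𝐗₀ < r. -/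
open Filter

/-- paper's Lemma 3.6, second part.
Let `𝐗` be a metric space with a scaling `(sc, ρ)` and `𝐗₀ ⊆ 𝐗` a nonempty subset
invariant under the scaling.  Then for every `R > 0` there is `r > 0` such that
`infDist x 𝐗₀ < R` implies `infDist (sc t x) 𝐗₀ < r` for all `t ≥ 0`. -/
theorem scaling_infDist_uniformly_bounded
    {X : Type*} [MetricSpace X]
    (sc : ℝ → X → X) (ρ : ℝ → ℝ → ℝ)
    (hρ_nonneg : ∀ t ≥ (0:ℝ), ∀ r ≥ (0:ℝ), 0 ≤ ρ t r)
    (hS3 : ∀ t ≥ (0:ℝ), ∀ x y : X, dist (sc t x) (sc t y) ≤ ρ t (dist x y))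
    (hS4 : ∀ t ≥ (0:ℝ), MonotoneOn (ρ t) (Set.Ici (0:ℝ)))
    (hS5bdd : ∀ r ≥ (0:ℝ), ∃ C : ℝ, ∀ t ≥ (0:ℝ), ρ t r ≤ C)
    (hS5lim : ∀ r ≥ (0:ℝ), Tendsto (fun t => ρ t r) atTop (nhds 0))
    (X₀ : Set X) (hne : X₀.Nonempty)
    (hinv : ∀ t ≥ (0:ℝ), ∀ x₀ ∈ X₀, sc t x₀ ∈ X₀) :
    ∀ R > (0:ℝ), ∃ r > (0:ℝ), ∀ x : X,
      Metric.infDist x X₀ < R → ∀ t ≥ (0:ℝ), Metric.infDist (sc t x) X₀ < r := by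
  intro R hR
  obtain ⟨C, hC⟩ := hS5bdd R hR.le
  have hC0 : 0 ≤ C := (hρ_nonneg 0 le_rfl R hR.le).trans (hC 0 le_rfl)
  refine ⟨C + 1, by linarith, fun x hx t ht => ?_⟩
  obtain ⟨y, hy, hxy⟩ := (Metric.infDist_lt_iff hne).1 hx
  calc Metric.infDist (sc t x) X₀
      ≤ dist (sc t x) (sc t y) := Metric.infDist_le_dist_of_mem (hinv t ht y hy)
    _ ≤ ρ t (dist x y) := hS3 t ht x y
    _ ≤ ρ t R := hS4 t ht dist_nonneg hR.le hxy.le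
    _ ≤ C := hC t ht
    _ < C + 1 := lt_add_one C
end

section
/- Let X be a metric space, R ≥ 0, k ∈ ℕ, and C ≥ 0. Suppose every closed ball of radius R in X contains at most k points, i.e. for every x the set {y ∈ X : dist x y ≤ R} has at most k elements. Let a : X → X → ℂ satisfy a x y = 0 whenever dist x y > R, and |a x y| ≤ C for all x, y. Then for every ξ ∈ ℓ²(X, ℂ) the function x ↦ ∑_{y} a x y * ξ y (for each x a sum with at most k nonzero terms) belongs to ℓ²(X, ℂ) and has ℓ²-norm at most k^{3/2} · C · ‖ξ‖₂; in particular the matrix a determines a bounded linear operator on ℓ²(X, ℂ) of operator norm at most k^{3/2} · C. -/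
section FinitePropagation

variable {X : Type*} {N : X → Finset X} {a : X → X → ℂ} {k : ℕ} {C : ℝ}

/-- Double counting along a symmetric relation with at most `k` neighbours per point. -/
theorem sum_sum_neighbors_le (hsymm : ∀ x y, y ∈ N x → x ∈ N y) (hcard : ∀ x, (N x).card ≤ k)
    (f : X → ℝ) (hf : ∀ x, 0 ≤ f x) {B : ℝ} (hB : ∀ u : Finset X, ∑ y ∈ u, f y ≤ B)
    (t : Finset X) : ∑ x ∈ t, ∑ y ∈ N x, f y ≤ k * B := by
  classical
  rw [Finset.sum_comm' (t' := t.biUnion N) (s' := fun y => t.filter fun x => y ∈ N x) (by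
    intro x y
    simp only [Finset.mem_filter, Finset.mem_biUnion]
    exact ⟨fun h => ⟨h, x, h⟩, fun h => h.1⟩)]
  calc ∑ y ∈ t.biUnion N, ∑ _x ∈ t.filter (fun x => y ∈ N x), f y
      ≤ ∑ y ∈ t.biUnion N, (k : ℝ) * f y := by
        refine Finset.sum_le_sum fun y _ => ?_
        rw [Finset.sum_const, nsmul_eq_mul]
        refine mul_le_mul_of_nonneg_right (Nat.cast_le.mpr ?_) (hf y)
        exact (Finset.card_le_card fun x hx => hsymm x y (Finset.mem_filter.mp hx).2).trans
          (hcard y)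
    _ ≤ k * B := by
        rw [← Finset.mul_sum]
        exact mul_le_mul_of_nonneg_left (hB _) k.cast_nonneg

theorem norm_sum_mul_sq_le (b ξ : X → ℂ) (hb : ∀ y, ‖b y‖ ≤ C) {s : Finset X}
    (hs : s.card ≤ k) : ‖∑ y ∈ s, b y * ξ y‖ ^ 2 ≤ k * C ^ 2 * ∑ y ∈ s, ‖ξ y‖ ^ 2 := by
  have h₁ : ‖∑ y ∈ s, b y * ξ y‖ ≤ C * ∑ y ∈ s, ‖ξ y‖ := by
    rw [Finset.mul_sum]
    refine norm_sum_le_of_le _ fun y _ => ?_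
    rw [norm_mul]
    exact mul_le_mul_of_nonneg_right (hb y) (norm_nonneg _)
  have hS : 0 ≤ ∑ y ∈ s, ‖ξ y‖ ^ 2 := Finset.sum_nonneg fun _ _ => sq_nonneg _
  calc ‖∑ y ∈ s, b y * ξ y‖ ^ 2 ≤ (C * ∑ y ∈ s, ‖ξ y‖) ^ 2 := by gcongr
    _ = C ^ 2 * (∑ y ∈ s, ‖ξ y‖) ^ 2 := mul_pow _ _ _
    _ ≤ C ^ 2 * (s.card * ∑ y ∈ s, ‖ξ y‖ ^ 2) := by
        gcongr
        exact sq_sum_le_card_mul_sum_sq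
    _ ≤ C ^ 2 * (k * ∑ y ∈ s, ‖ξ y‖ ^ 2) := by gcongr
    _ = k * C ^ 2 * ∑ y ∈ s, ‖ξ y‖ ^ 2 := by ring

theorem sum_norm_matrix_mul_sq_le (hsymm : ∀ x y, y ∈ N x → x ∈ N y)
    (hcard : ∀ x, (N x).card ≤ k) (hbdd : ∀ x y, ‖a x y‖ ≤ C)
    (ξ : lp (fun _ : X => ℂ) 2) (t : Finset X) :
    ∑ x ∈ t, ‖∑ y ∈ N x, a x y * ξ y‖ ^ 2 ≤ (k * C * ‖ξ‖) ^ 2 := by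
  have hξ (u : Finset X) : ∑ y ∈ u, ‖ξ y‖ ^ 2 ≤ ‖ξ‖ ^ 2 := by
    simpa using lp.sum_rpow_le_norm_rpow (p := 2) (by simp) ξ u
  calc ∑ x ∈ t, ‖∑ y ∈ N x, a x y * ξ y‖ ^ 2
      ≤ ∑ x ∈ t, k * C ^ 2 * ∑ y ∈ N x, ‖ξ y‖ ^ 2 :=
        Finset.sum_le_sum fun x _ => norm_sum_mul_sq_le (a x) ξ (hbdd x) (hcard x)
    _ = k * C ^ 2 * ∑ x ∈ t, ∑ y ∈ N x, ‖ξ y‖ ^ 2 := (Finset.mul_sum _ _ _).symm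
    _ ≤ k * C ^ 2 * (k * ‖ξ‖ ^ 2) := by
        gcongr
        exact sum_sum_neighbors_le hsymm hcard _ (fun _ => sq_nonneg _) hξ t
    _ = (k * C * ‖ξ‖) ^ 2 := by ring

end FinitePropagation

theorem Nat.cast_le_rpow_three_halves (k : ℕ) : (k : ℝ) ≤ (k : ℝ) ^ ((3 : ℝ) / 2) := by
  rcases Nat.eq_zero_or_pos k with rfl | hk
  · simp
  · exact Real.self_le_rpow_of_one_le (Nat.one_le_cast.mpr hk) (by norm_num)


/-- Hilbert-space form of the paper's Lemma 2.6.
Let `X` be a metric space in which every closed `R`-ball has at most `k` points,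
and let `a : X → X → ℂ` be a matrix with propagation at most `R` and entries
bounded by `C`.  Then for every `ξ ∈ ℓ²(X, ℂ)` the function
`x ↦ ∑' y, a x y * ξ y` lies in `ℓ²(X, ℂ)` with norm at most `k^(3/2) * C * ‖ξ‖`,
and `a` determines a bounded operator on `ℓ²(X, ℂ)` of norm at most `k^(3/2) * C`. -/
theorem matrix_bounded_of_finite_propagation
    {X : Type*} [MetricSpace X] (R : ℝ) (hR : 0 ≤ R) (k : ℕ) (C : ℝ) (hC : 0 ≤ C)
    (hgeom : ∀ x : X, ∃ s : Finset X, {y : X | dist x y ≤ R} ⊆ ↑s ∧ s.card ≤ k)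
    (a : X → X → ℂ)
    (hsupp : ∀ x y : X, R < dist x y → a x y = 0)
    (hbdd : ∀ x y : X, ‖a x y‖ ≤ C) :
    (∀ ξ : lp (fun _ : X => ℂ) 2,
      ∃ h : Memℓp (fun x : X => ∑' y : X, a x y * ξ y) 2,
        ‖(⟨fun x : X => ∑' y : X, a x y * ξ y, h⟩ : lp (fun _ : X => ℂ) 2)‖ ≤
          (k : ℝ) ^ ((3 : ℝ) / 2) * C * ‖ξ‖) ∧
    ∃ T : lp (fun _ : X => ℂ) 2 →L[ℂ] lp (fun _ : X => ℂ) 2,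
      ‖T‖ ≤ (k : ℝ) ^ ((3 : ℝ) / 2) * C ∧
      ∀ (ξ : lp (fun _ : X => ℂ) 2) (x : X), T ξ x = ∑' y : X, a x y * ξ y := by
  classical
  obtain ⟨N, hN, hcard⟩ : ∃ N : X → Finset X, (∀ x y, y ∈ N x ↔ dist x y ≤ R) ∧
      ∀ x, (N x).card ≤ k := by
    choose s hs hk using hgeom
    refine ⟨fun x => (s x).filter fun y => dist x y ≤ R, fun x y => ?_, fun x =>
      (Finset.card_filter_le _ _).trans (hk x)⟩
    rw [Finset.mem_filter]
    exact ⟨fun h => h.2, fun h => ⟨hs x h, h⟩⟩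
  have hsymm : ∀ x y, y ∈ N x → x ∈ N y := fun x y h => by
    rw [hN, dist_comm]
    exact (hN x y).mp h
  have htsum (ξ : X → ℂ) (x : X) : ∑' y, a x y * ξ y = ∑ y ∈ N x, a x y * ξ y :=
    tsum_eq_sum fun y hy => by
      rw [hsupp x y (not_le.mp fun h => hy ((hN x y).mpr h)), zero_mul]
  have hsum (ξ : lp (fun _ : X => ℂ) 2) (t : Finset X) :
      ∑ x ∈ t, ‖∑' y, a x y * ξ y‖ ^ (2 : ENNReal).toReal ≤
        (k * C * ‖ξ‖) ^ (2 : ENNReal).toReal := by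
    simpa [htsum] using sum_norm_matrix_mul_sq_le hsymm hcard hbdd ξ t
  have hmem (ξ : lp (fun _ : X => ℂ) 2) : Memℓp (fun x => ∑' y, a x y * ξ y) 2 :=
    memℓp_gen' (hsum ξ)
  have hnorm (ξ : lp (fun _ : X => ℂ) 2) :
      ‖(⟨fun x => ∑' y, a x y * ξ y, hmem ξ⟩ : lp (fun _ : X => ℂ) 2)‖ ≤
        (k : ℝ) ^ ((3 : ℝ) / 2) * C * ‖ξ‖ := by
    refine (lp.norm_le_of_forall_sum_le (by simp) (by positivity) (hsum ξ)).trans ?_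
    gcongr
    exact Nat.cast_le_rpow_three_halves k
  let L : lp (fun _ : X => ℂ) 2 →ₗ[ℂ] lp (fun _ : X => ℂ) 2 :=
    { toFun := fun ξ => ⟨fun x => ∑' y, a x y * ξ y, hmem ξ⟩
      map_add' := fun ξ η => by
        ext x
        change ∑' y, a x y * (ξ + η : X → ℂ) y = ∑' y, a x y * ξ y + ∑' y, a x y * η y
        rw [htsum, htsum, htsum]
        simp only [Pi.add_apply, mul_add, Finset.sum_add_distrib]
      map_smul' := fun c ξ => by
        ext x
        change ∑' y, a x y * (c • ξ : X → ℂ) y = c * ∑' y, a x y * ξ y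
        rw [htsum, htsum]
        simp only [Pi.smul_apply, smul_eq_mul, Finset.mul_sum, mul_left_comm] }
  exact ⟨fun ξ => ⟨hmem ξ, hnorm ξ⟩, L.mkContinuous _ hnorm,
    L.mkContinuous_norm_le (by positivity) hnorm, fun _ _ => rfl⟩
end

section
/- Let 𝐗 be a proper metric space with a scaling (sc, ρ), let f ∈ C₀(𝐗, ℂ), and let Δ > 0 and ε > 0. Then there exists N ≥ 0 such that for all t > N and all u, v ∈ 𝐗 with dist u v ≤ Δ one has |f (sc t u) − f (sc t v)| ≤ ε. -/
open Filter
open scoped ZeroAtInfty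

/-- inequality (3.3) in the proof of the paper's Proposition 3.19.
Let `𝐗` be a proper metric space with a scaling `(sc, ρ)`, `f ∈ C₀(𝐗, ℂ)`,
`Δ > 0` and `ε > 0`.  Then there is `N ≥ 0` such that for all `t > N` and all
`u, v` with `dist u v ≤ Δ` one has `‖f (sc t u) − f (sc t v)‖ ≤ ε`. -/
theorem scaling_uniform_contraction_on_zeroAtInfty
    {X : Type*} [MetricSpace X] [ProperSpace X]
    (sc : ℝ → X → X) (ρ : ℝ → ℝ → ℝ)
    (hρ_nonneg : ∀ t ≥ (0:ℝ), ∀ r ≥ (0:ℝ), 0 ≤ ρ t r)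
    (hS3 : ∀ t ≥ (0:ℝ), ∀ x y : X, dist (sc t x) (sc t y) ≤ ρ t (dist x y))
    (hS4 : ∀ t ≥ (0:ℝ), MonotoneOn (ρ t) (Set.Ici (0:ℝ)))
    (hS5bdd : ∀ r ≥ (0:ℝ), ∃ C : ℝ, ∀ t ≥ (0:ℝ), ρ t r ≤ C)
    (hS5lim : ∀ r ≥ (0:ℝ), Tendsto (fun t => ρ t r) atTop (nhds 0))
    (f : C₀(X, ℂ)) (Δ : ℝ) (hΔ : 0 < Δ) (ε : ℝ) (hε : 0 < ε) :
    ∃ N ≥ (0:ℝ), ∀ t > N, ∀ u v : X, dist u v ≤ Δ →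
      ‖f (sc t u) - f (sc t v)‖ ≤ ε := by
  obtain ⟨δ, hδ, hf⟩ :=
    Metric.uniformContinuous_iff.mp (ZeroAtInftyContinuousMap.uniformContinuous f) ε hε
  obtain ⟨N, hN⟩ := eventually_atTop.mp ((hS5lim Δ hΔ.le).eventually_lt_const hδ)
  refine ⟨max N 0, le_max_right _ _, fun t ht u v huv => ?_⟩
  obtain ⟨htN, ht0⟩ := max_lt_iff.mp ht
  rw [← dist_eq_norm]
  refine (hf ?_).le
  calc dist (sc t u) (sc t v) ≤ ρ t (dist u v) := hS3 t ht0.le u v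
    _ ≤ ρ t Δ := hS4 t ht0.le dist_nonneg hΔ.le huv
    _ < δ := hN t htN.le
end

section
/- Let 𝐗 be a proper metric space with a scaling (sc, ρ), let 𝐗₀ ⊆ 𝐗 be nonempty and closed with sc t x₀ ∈ 𝐗₀ for all t ≥ 0 and x₀ ∈ 𝐗₀, and let Δ > 0. Let X ⊆ 𝐗 be Δ-separated and a Δ-net, and let (α_x)_{x ∈ X} be a family of continuous functions α_x : 𝐗 → [0,1] such that α_x z = 0 whenever dist z x ≥ Δ and ∑_{x ∈ X} (α_x z)² = 1 for every z ∈ 𝐗. For x ∈ X let χ_x = 1 if Metric.infDist x 𝐗₀ > Δ and χ_x = 0 otherwise. Let r > 0 and let f ∈ C₀(𝐗, ℂ) satisfy f w = 0 whenever dist w x₀ < r for some x₀ ∈ 𝐗₀. Then for every ε > 0 there exists N ≥ 0 such that for all t > N, all x, y ∈ X, and all z ∈ 𝐗: |α_x (sc t z)| · |α_y (sc t z)| · |f (sc t (sc t z)) − χ_x · χ_y · f (sc t y)| ≤ ε. -/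
open Filter
open scoped ZeroAtInfty

/-- the Claim, inequality (3.5), in the proof of the paper's
Proposition 3.19.  With `𝐗` a proper metric space with scaling `(sc, ρ)`,
`𝐗₀ ⊆ 𝐗` nonempty, closed and scaling-invariant, `D ⊆ 𝐗` a `Δ`-separated
`Δ`-net, `(α_x)_{x ∈ D}` a square partition of unity subordinate to the `Δ`-balls
around `D`, `χ_x` the indicator of `infDist x 𝐗₀ > Δ`, and `f ∈ C₀(𝐗, ℂ)`
vanishing on the open `r`-neighborhood of `𝐗₀`: for every `ε > 0` there is
`N ≥ 0` such that for all `t > N`, `x, y ∈ D` and `z ∈ 𝐗`,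
`|α_x (sc t z)| · |α_y (sc t z)| · ‖f (sc t (sc t z)) − χ_x χ_y f (sc t y)‖ ≤ ε`. -/
theorem scaling_partition_claim
    {X : Type*} [MetricSpace X] [ProperSpace X]
    (sc : ℝ → X → X) (ρ : ℝ → ℝ → ℝ)
    (hρ_nonneg : ∀ t ≥ (0:ℝ), ∀ r ≥ (0:ℝ), 0 ≤ ρ t r)
    (hS3 : ∀ t ≥ (0:ℝ), ∀ x y : X, dist (sc t x) (sc t y) ≤ ρ t (dist x y))
    (hS4 : ∀ t ≥ (0:ℝ), MonotoneOn (ρ t) (Set.Ici (0:ℝ)))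
    (hS5bdd : ∀ r ≥ (0:ℝ), ∃ C : ℝ, ∀ t ≥ (0:ℝ), ρ t r ≤ C)
    (hS5lim : ∀ r ≥ (0:ℝ), Tendsto (fun t => ρ t r) atTop (nhds 0))
    (X₀ : Set X) (hne : X₀.Nonempty) (hcl : IsClosed X₀)
    (hinv : ∀ t ≥ (0:ℝ), ∀ x₀ ∈ X₀, sc t x₀ ∈ X₀)
    (Δ : ℝ) (hΔ : 0 < Δ)
    (D : Set X)
    (hsep : ∀ x ∈ D, ∀ x' ∈ D, x ≠ x' → Δ ≤ dist x x')
    (hnet : ∀ y : X, ∃ x ∈ D, dist y x < Δ)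
    (α : X → X → ℝ)
    (hαcont : ∀ x ∈ D, Continuous (α x))
    (hα01 : ∀ x ∈ D, ∀ z : X, α x z ∈ Set.Icc (0:ℝ) 1)
    (hαsupp : ∀ x ∈ D, ∀ z : X, Δ ≤ dist z x → α x z = 0)
    (hαsum : ∀ z : X, HasSum (fun x : D => (α x z) ^ 2) 1)
    (χ : X → ℝ)
    (hχ : ∀ x : X, χ x = if Δ < Metric.infDist x X₀ then 1 else 0)
    (r : ℝ) (hr : 0 < r) (f : C₀(X, ℂ))
    (hf : ∀ w : X, (∃ x₀ ∈ X₀, dist w x₀ < r) → f w = 0) :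
    ∀ ε > (0:ℝ), ∃ N ≥ (0:ℝ), ∀ t > N, ∀ x ∈ D, ∀ y ∈ D, ∀ z : X,
      |α x (sc t z)| * |α y (sc t z)| *
        ‖f (sc t (sc t z)) - (χ x * χ y) • f (sc t y)‖ ≤ ε := by
  intro ε hε
  obtain ⟨δ, hδ, hfδ⟩ :=
    Metric.uniformContinuous_iff.1 (ZeroAtInftyContinuousMap.uniformContinuous f) ε hε
  have hev : ∀ᶠ t in atTop, ρ t Δ < δ ∧ ρ t (2 * Δ) < r :=
    ((hS5lim Δ hΔ.le).eventually_lt_const hδ).and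
      ((hS5lim (2 * Δ) (by positivity)).eventually_lt_const hr)
  obtain ⟨N, hN⟩ := eventually_atTop.1 hev
  refine ⟨max N 0, le_max_right _ _, fun t ht x hx y hy z => ?_⟩
  have ht0 : 0 ≤ t := (le_max_right _ _).trans ht.le
  obtain ⟨htδ, htr⟩ := hN t ((le_max_left _ _).trans ht.le)
  have hdist : ∀ u v : X, ∀ s, dist u v ≤ s → dist (sc t u) (sc t v) ≤ ρ t s := fun u v s h =>
    (hS3 t ht0 u v).trans (hS4 t ht0 dist_nonneg (dist_nonneg.trans h) h)
  generalize sc t z = w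
  rcases le_or_gt Δ (dist w x) with hwx | hwx
  · simp [hαsupp x hx w hwx, hε.le]
  rcases le_or_gt Δ (dist w y) with hwy | hwy
  · simp [hαsupp y hy w hwy, hε.le]
  have habs : ∀ v ∈ D, |α v w| ≤ 1 := fun v hv =>
    abs_le.2 ⟨by linarith [(hα01 v hv w).1], (hα01 v hv w).2⟩
  have hzero : ∀ v, dist w v < Δ → ¬ Δ < Metric.infDist v X₀ → f (sc t w) = 0 := by
    intro v hwv hv
    have hlt : Metric.infDist w X₀ < 2 * Δ := by
      linarith [Metric.infDist_le_infDist_add_dist (s := X₀) (x := w) (y := v), not_lt.1 hv]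
    obtain ⟨x₀, hx₀, hwx₀⟩ := (Metric.infDist_lt_iff hne).1 hlt
    exact hf _ ⟨sc t x₀, hinv t ht0 x₀ hx₀, (hdist _ _ _ hwx₀.le).trans_lt htr⟩
  have hnorm : ‖f (sc t w) - (χ x * χ y) • f (sc t y)‖ ≤ ε := by
    rw [hχ x, hχ y]
    by_cases hx' : Δ < Metric.infDist x X₀
    · by_cases hy' : Δ < Metric.infDist y X₀
      · simpa [hx', hy', dist_eq_norm] using (hfδ ((hdist w y Δ hwy.le).trans_lt htδ)).le
      · simp [hy', hzero y hwy hy', hε.le]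
    · simp [hx', hzero x hwx hx', hε.le]
  exact (mul_le_of_le_one_left (norm_nonneg _)
    (mul_le_one₀ (habs x hx) (abs_nonneg _) (habs y hy))).trans hnorm
end

section
/- Let B be a C*-algebra and r : [0,∞) → [0,∞) a homeomorphism. For a bounded continuous function f : [0,∞) → B define H f : [0,∞) → C([0,1], B) by (H f) t s = f ((1 − s) · r t + s · t). Then: (a) for every bounded continuous f, H f is a well-defined bounded continuous function from [0,∞) into the C*-algebra C([0,1], B), and the resulting map H from C_b([0,∞), B) to C_b([0,∞), C([0,1], B)) is linear, multiplicative and star-preserving; (b) (H f) t 0 = f (r t) and (H f) t 1 = f t for all t; (c) if f vanishes at infinity, then the function t ↦ sup_{s ∈ [0,1]} ‖(H f) t s‖ vanishes at infinity. -/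
open Filter
open scoped NNReal BoundedContinuousFunction

/-- The straight-line path `s ↦ (1 - s) · r t + s · t` in `[0,∞)`, jointly continuous in
`(t, s)`. -/
noncomputable def reparamPath (r : C(ℝ≥0, ℝ≥0)) : C(ℝ≥0 × Set.Icc (0:ℝ) 1, ℝ≥0) where
  toFun p := Real.toNNReal ((1 - (p.2 : ℝ)) * ((r p.1 : ℝ≥0) : ℝ)
    + (p.2 : ℝ) * ((p.1 : ℝ≥0) : ℝ))
  continuous_toFun := by fun_prop

/-- A point of the straight-line path from `r t` to `t` lies above every common lower bound of
its endpoints. -/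
lemma le_reparamPath (r : C(ℝ≥0, ℝ≥0)) {N t : ℝ≥0} (hr : N ≤ r t) (ht : N ≤ t)
    (s : Set.Icc (0:ℝ) 1) : N ≤ reparamPath r (t, s) := by
  apply NNReal.le_toNNReal_of_coe_le
  have h1 : (N : ℝ) ≤ r t := by exact_mod_cast hr
  have h2 : (N : ℝ) ≤ t := by exact_mod_cast ht
  obtain ⟨s, hs0, hs1⟩ := s
  dsimp only
  nlinarith [mul_le_mul_of_nonneg_left h1 (sub_nonneg.2 hs1), mul_le_mul_of_nonneg_left h2 hs0]

/-- Composition of a bounded continuous function with the straight-line path from `r` to the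
identity, as a bounded continuous function with values in the paths in `B`. -/
noncomputable def reparamHomotopy {B : Type*} [NonUnitalNormedRing B] (r : C(ℝ≥0, ℝ≥0))
    (f : ℝ≥0 →ᵇ B) : ℝ≥0 →ᵇ C(Set.Icc (0:ℝ) 1, B) :=
  BoundedContinuousFunction.ofNormedAddCommGroup
    (f.toContinuousMap.comp (reparamPath r)).curry (ContinuousMap.continuous _) ‖f‖
    fun _ => (ContinuousMap.norm_le _ (norm_nonneg f)).2 fun _ => f.norm_coe_le_norm _

lemma reparamHomotopy_apply {B : Type*} [NonUnitalNormedRing B] (r : C(ℝ≥0, ℝ≥0))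
    (f : ℝ≥0 →ᵇ B) (t : ℝ≥0) (s : Set.Icc (0:ℝ) 1) :
    reparamHomotopy r f t s = f (reparamPath r (t, s)) := rfl

lemma tendsto_norm_reparamHomotopy {B : Type*} [NonUnitalNormedRing B] {r : C(ℝ≥0, ℝ≥0)}
    (hr : Tendsto r atTop atTop) {f : ℝ≥0 →ᵇ B}
    (hf : Tendsto (fun t => ‖f t‖) atTop (nhds 0)) :
    Tendsto (fun t => ‖reparamHomotopy r f t‖) atTop (nhds 0) := by
  rw [Metric.tendsto_nhds]
  intro ε hε
  obtain ⟨N, hN⟩ := eventually_atTop.1 (hf.eventually (gt_mem_nhds hε))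
  filter_upwards [hr.eventually_ge_atTop N, eventually_ge_atTop N] with t hrt ht
  rw [dist_zero_right, norm_norm]
  exact (ContinuousMap.norm_lt_iff _ hε).2 fun s => hN _ (le_reparamPath r hrt ht s)

/-- core of the paper's Lemma 4.9.
Let `B` be a C*-algebra and `r : [0,∞) → [0,∞)` a homeomorphism.  The assignment
`(H f) t s = f ((1 − s) · r t + s · t)` defines a linear, multiplicative,
star-preserving map from `C_b([0,∞), B)` to `C_b([0,∞), C([0,1], B))` with
`(H f) t 0 = f (r t)`, `(H f) t 1 = f t`, and `H f` vanishes at infinity whenever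
`f` does. -/
theorem reparametrization_homotopy_homomorphism
    {B : Type*} [NonUnitalNormedRing B] [StarRing B] [CStarRing B]
    [CompleteSpace B] [NormedSpace ℂ B] [IsScalarTower ℂ B B] [SMulCommClass ℂ B B]
    [StarModule ℂ B]
    (r : ℝ≥0 ≃ₜ ℝ≥0) :
    ∃ H : (ℝ≥0 →ᵇ B) → (ℝ≥0 →ᵇ C(Set.Icc (0:ℝ) 1, B)),
      (∀ (f : ℝ≥0 →ᵇ B) (t : ℝ≥0) (s : Set.Icc (0:ℝ) 1),
        H f t s = f (Real.toNNReal ((1 - (s : ℝ)) * ((r t : ℝ≥0) : ℝ)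
          + (s : ℝ) * ((t : ℝ≥0) : ℝ)))) ∧
      (∀ f g : ℝ≥0 →ᵇ B, H (f + g) = H f + H g) ∧
      (∀ (c : ℂ) (f : ℝ≥0 →ᵇ B), H (c • f) = c • H f) ∧
      (∀ f g : ℝ≥0 →ᵇ B, H (f * g) = H f * H g) ∧
      (∀ f : ℝ≥0 →ᵇ B, H (star f) = star (H f)) ∧
      (∀ (f : ℝ≥0 →ᵇ B) (t : ℝ≥0),
        H f t (⟨0, by norm_num⟩ : Set.Icc (0:ℝ) 1) = f (r t)) ∧
      (∀ (f : ℝ≥0 →ᵇ B) (t : ℝ≥0),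
        H f t (⟨1, by norm_num⟩ : Set.Icc (0:ℝ) 1) = f t) ∧
      (∀ f : ℝ≥0 →ᵇ B, Tendsto (fun t => ‖f t‖) atTop (nhds 0) →
        Tendsto (fun t => ‖H f t‖) atTop (nhds 0)) := by
  have hr : Tendsto (r : C(ℝ≥0, ℝ≥0)) atTop atTop := by
    have h := r.isClosedEmbedding.tendsto_cocompact
    rwa [cocompact_eq_atTop] at h
  refine ⟨reparamHomotopy (r : C(ℝ≥0, ℝ≥0)), fun _ _ _ => rfl, fun _ _ => rfl, fun _ _ => rfl,
    fun _ _ => rfl, fun _ => rfl, fun f t => ?_, fun f t => ?_,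
    fun f => tendsto_norm_reparamHomotopy hr⟩
  · simp [reparamHomotopy_apply, reparamPath]
  · simp [reparamHomotopy_apply, reparamPath]
end

section
/- Let 𝐗 be a proper metric space and sc : [0,∞) × 𝐗 → 𝐗 a jointly continuous map such that for every bounded set S ⊆ 𝐗 and every T > 0 the set {x ∈ 𝐗 : ∃ t ∈ [0,T], sc (t, x) ∈ S} is bounded. Let Δ > 0, let X ⊆ 𝐗 be Δ-separated (dist x x' ≥ Δ for all distinct x, x' ∈ X), and let α : 𝐗 → ℝ be continuous with bounded support. Then the map τ ↦ (x ↦ α (sc (τ, x))), from [0,∞) to the space of bounded functions X → ℝ with the sup norm, is well-defined and continuous. -/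
open scoped NNReal ENNReal

open Topology

/-- A jointly continuous family of functions that, locally in the parameter, vanishes outside a
common compact set depends continuously on the parameter uniformly in the space variable. -/
theorem tendstoUniformly_of_locally_eq_zero_off_compact
    {P X E : Type*} [TopologicalSpace P] [TopologicalSpace X] [UniformSpace E] [Zero E]
    {g : P → X → E} (hg : Continuous (Function.uncurry g)) {p₀ : P} {U : Set P} (hU : U ∈ 𝓝 p₀)
    {K : Set X} (hK : IsCompact K) (hzero : ∀ p ∈ U, ∀ x ∉ K, g p x = 0) :
    TendstoUniformly g (g p₀) (𝓝 p₀) := by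
  intro u hu
  obtain ⟨v, hv, hvK⟩ := hK.mem_uniformity_of_prod (s := Set.univ) hg.continuousOn
    (Set.mem_univ p₀) (symm_le_uniformity hu)
  rw [nhdsWithin_univ] at hv
  filter_upwards [hU, hv] with p hpU hpv x
  by_cases hx : x ∈ K
  · exact hvK p hpv x hx
  · rw [hzero p hpU x hx, hzero p₀ (mem_of_mem_nhds hU) x hx]
    exact refl_mem_uniformity hu

/-- Claim 1 in the proof of the paper's Proposition 3.20.
Let `𝐗` be a proper metric space and `sc : [0,∞) × 𝐗 → 𝐗` jointly continuous such
that preimages of bounded sets under bounded time intervals are bounded (condition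
(S2)).  Let `X ⊆ 𝐗` be `Δ`-separated and `α : 𝐗 → ℝ` continuous with bounded
support.  Then `τ ↦ (x ∈ X ↦ α (sc τ x))` is a well-defined continuous map into
the bounded functions on `X` with the sup norm (here `ℓ∞(X, ℝ)`). -/
theorem diagonal_multiplier_continuous
    {X : Type*} [MetricSpace X] [ProperSpace X]
    (sc : ℝ≥0 → X → X)
    (hcont : Continuous fun p : ℝ≥0 × X => sc p.1 p.2)
    (hS2 : ∀ S : Set X, Bornology.IsBounded S → ∀ T : ℝ≥0, 0 < T →
      Bornology.IsBounded {x : X | ∃ t : ℝ≥0, t ≤ T ∧ sc t x ∈ S})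
    (Δ : ℝ) (hΔ : 0 < Δ) (D : Set X)
    (hsep : ∀ x ∈ D, ∀ x' ∈ D, x ≠ x' → Δ ≤ dist x x')
    (α : X → ℝ) (hα : Continuous α)
    (hsupp : Bornology.IsBounded (Function.support α)) :
    ∃ F : ℝ≥0 → lp (fun _ : D => ℝ) ∞,
      Continuous F ∧ ∀ (τ : ℝ≥0) (x : D), F τ x = α (sc τ x) := by
  have hαc : HasCompactSupport α := hsupp.isCompact_closure
  obtain ⟨C, hC⟩ := hαc.exists_bound_of_continuous hα
  have hmem (τ : ℝ≥0) : Memℓp (fun x : D => α (sc τ x)) ∞ :=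
    memℓp_infty ⟨C, by rintro _ ⟨x, rfl⟩; exact hC _⟩
  refine ⟨fun τ => ⟨fun x => α (sc τ x), hmem τ⟩, ?_, fun _ _ => rfl⟩
  refine continuous_iff_continuousAt.2 fun τ₀ => ?_
  have hunif : TendstoUniformly (fun τ x => α (sc τ x)) (fun x => α (sc τ₀ x)) (𝓝 τ₀) := by
    refine tendstoUniformly_of_locally_eq_zero_off_compact (g := fun τ x => α (sc τ x))
      (hα.comp hcont) (Iic_mem_nhds (lt_add_one τ₀))
      (hS2 _ hsupp (τ₀ + 1) (by positivity)).isCompact_closure fun τ hτ x hx => ?_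
    by_contra h
    exact hx (subset_closure ⟨τ, hτ, h⟩)
  refine Metric.tendsto_nhds.2 fun ε hε => ?_
  filter_upwards [Metric.tendstoUniformly_iff.1 hunif (ε / 2) (half_pos hε)] with τ hτ
  rw [dist_eq_norm]
  refine (lp.norm_le_of_forall_le (half_pos hε).le fun x => ?_).trans_lt (half_lt_self hε)
  have h := (hτ x).le
  rwa [dist_comm, dist_eq_norm] at h
end
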